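/- arXiv:1008.3577 — 5 statements merged into one kernel-verified Lean document; each statement's English description precedes it below -/
import Mathlib

section
/- Let P ⊂ ℝⁿ be a bounded open convex set, T > 0, and let u₀ and u̇₀ be C¹ functions on P. For s ∈ [0,T] set u_s := u₀ + s·u̇₀ and define ψ(s,x) := sup_{y∈P}( ⟨x,y⟩ − u_s(y) ). Assume ψ is finite and of class C² on [0,T] × ℝⁿ, and that for each (s,x) the supremum is attained at a unique point y(s,x) ∈ P. Then: (i) ∇_x ψ(s,x) = y(s,x) and ∂ψ/∂s(s,x) = −u̇₀(∇_x ψ(s,x)); (ii) the (n+1)×(n+1) Hessian matrix of ψ with respect to the joint variables (s,x) has determinant identically zero on (0,T) × ℝⁿ, i.e. ψ solves the homogeneous real Monge–Ampère equation MA ψ = 0; (iii) ψ(0,·) is the Legendre transform of u₀ and ∂ψ/∂s(0,x) = −u̇₀(∇(ψ(0,·))(x)). -/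
open scoped RealInnerProductSpace
open Set

noncomputable section

/-- The standard basis of the joint variable space `ℝ × ℝⁿ`: index `0` is the `s`-direction,
index `j+1` is the `j`-th coordinate direction of `ℝⁿ`. -/
def baseVec (n : ℕ) : Fin (n + 1) → ℝ × EuclideanSpace ℝ (Fin n) :=
  Fin.cases ((1 : ℝ), 0) fun j => ((0 : ℝ), EuclideanSpace.single j 1)

/-- The `(n+1) × (n+1)` Hessian matrix of a function of the joint variable `(s,x) ∈ ℝ × ℝⁿ`,
whose determinant is the real Monge–Ampère operator. -/
def hessMat (n : ℕ) (Ψ : ℝ × EuclideanSpace ℝ (Fin n) → ℝ)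
    (p : ℝ × EuclideanSpace ℝ (Fin n)) : Matrix (Fin (n + 1)) (Fin (n + 1)) ℝ :=
  Matrix.of fun i j => iteratedFDeriv ℝ 2 Ψ p ![baseVec n i, baseVec n j]

open Filter Topology

section Envelope

variable {E : Type*} [NormedAddCommGroup E] [InnerProductSpace ℝ E]

/-- If `Ψ (s, ·)` touches the affine function `⟪·, y⟫ - c` from above at `x`, then the spatial part
of the derivative of `Ψ` at `(s, x)` is `⟪y, ·⟫`. -/
theorem fderivWithin_prod_apply_inr_of_touching {I : Set ℝ} {Ψ : ℝ × E → ℝ} {s c : ℝ} {x y : E}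
    (hs : s ∈ I) (hd : DifferentiableWithinAt ℝ Ψ (I ×ˢ univ) (s, x))
    (hle : ∀ z, ⟪z, y⟫ - c ≤ Ψ (s, z)) (heq : Ψ (s, x) = ⟪x, y⟫ - c) :
    HasFDerivAt (fun z => Ψ (s, z)) (innerSL ℝ y) x ∧
      ∀ v, fderivWithin ℝ Ψ (I ×ˢ univ) (s, x) (0, v) = ⟪y, v⟫ := by
  have hslice : HasFDerivAt (fun z => Ψ (s, z))
      ((fderivWithin ℝ Ψ (I ×ˢ univ) (s, x)).comp (ContinuousLinearMap.inr ℝ ℝ E)) x := by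
    have h := hd.hasFDerivWithinAt.comp (s := univ) x
      (hasFDerivAt_prodMk_right (𝕜 := ℝ) s x).hasFDerivWithinAt
      (fun z _ => ⟨hs, mem_univ _⟩)
    exact hasFDerivWithinAt_univ.1 h
  have hlin : HasFDerivAt (fun z : E => ⟪z, y⟫ - c) (innerSL ℝ y) x := by
    have h := ((innerSL ℝ y).hasFDerivAt (x := x)).sub_const c
    refine h.congr_of_eventuallyEq (Eventually.of_forall fun z => ?_)
    simp [real_inner_comm]
  have hmin : IsLocalMin (fun z => Ψ (s, z) - (⟪z, y⟫ - c)) x :=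
    Eventually.of_forall fun z => by
      have := hle z
      simp only
      linarith
  have hzero := hmin.hasFDerivAt_eq_zero (hslice.sub hlin)
  have hD := sub_eq_zero.1 hzero
  refine ⟨hD ▸ hslice, fun v => ?_⟩
  simpa using DFunLike.congr_fun hD v

/-- The time part of the derivative of a function on `I × E` is the derivative of the time slice. -/
theorem hasDerivWithinAt_prod_slice {I : Set ℝ} {Ψ : ℝ × E → ℝ} {s : ℝ} {x : E}
    (hd : DifferentiableWithinAt ℝ Ψ (I ×ˢ univ) (s, x)) :
    HasDerivWithinAt (fun t => Ψ (t, x)) (fderivWithin ℝ Ψ (I ×ˢ univ) (s, x) (1, 0)) I s := by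
  have hmaps : MapsTo (fun t : ℝ => (t, x)) I (I ×ˢ univ) := fun t ht => ⟨ht, mem_univ _⟩
  exact hd.hasFDerivWithinAt.comp_hasDerivWithinAt s
    ((hasDerivWithinAt_id s I).prodMk (hasDerivWithinAt_const s I x)) hmaps

/-- If `Ψ (·, x)` touches the affine function `b - t * a` from above at an interior time `s`, then
its time derivative at `s` is `-a`. -/
theorem fderivWithin_prod_apply_inl_of_touching {I : Set ℝ} {Ψ : ℝ × E → ℝ} {s a b : ℝ} {x : E}
    (hs : I ∈ 𝓝 s) (hd : DifferentiableWithinAt ℝ Ψ (I ×ˢ univ) (s, x))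
    (hle : ∀ t ∈ I, b - t * a ≤ Ψ (t, x)) (heq : Ψ (s, x) = b - s * a) :
    fderivWithin ℝ Ψ (I ×ˢ univ) (s, x) (1, 0) = -a := by
  have hslice := (hasDerivWithinAt_prod_slice hd).hasDerivAt hs
  have hlin : HasDerivAt (fun t : ℝ => b - t * a) (-a) s := by
    simpa using ((hasDerivAt_id s).mul_const a).const_sub b
  have hmin : IsLocalMin (fun t => Ψ (t, x) - (b - t * a)) s := by
    filter_upwards [hs] with t ht
    have := hle t ht
    linarith
  have := hmin.hasDerivAt_eq_zero (hslice.sub hlin)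
  linarith

/-- If the time derivative of a `C²` function is a differentiable function of its spatial gradient,
then its Hessian annihilates a vector with time component `1`. -/
theorem exists_fderiv_fderiv_apply_eq_zero [CompleteSpace E] {Ψ : ℝ × E → ℝ} {w : E → ℝ}
    {p : ℝ × E} {Y : ℝ × E → E} (hΨ : DifferentiableAt ℝ (fderiv ℝ Ψ) p)
    (hY : ∀ᶠ q in 𝓝 p, ∀ v, fderiv ℝ Ψ q (0, v) = ⟪Y q, v⟫)
    (ht : ∀ᶠ q in 𝓝 p, fderiv ℝ Ψ q (1, 0) = -w (Y q))
    (hw : DifferentiableAt ℝ w (Y p)) :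
    ∃ a : E, ∀ v, fderiv ℝ (fderiv ℝ Ψ) p v (1, a) = 0 := by
  refine ⟨gradient w (Y p), fun v => ?_⟩
  set H := fderiv ℝ (fderiv ℝ Ψ) p
  have hYdiff : HasFDerivAt Y
      ((InnerProductSpace.toDual ℝ E).symm.toContinuousLinearEquiv.toContinuousLinearMap.comp
        (((ContinuousLinearMap.compL ℝ E (ℝ × E) ℝ).flip (ContinuousLinearMap.inr ℝ ℝ E)).comp H))
      p := by
    have h1 := ((ContinuousLinearMap.compL ℝ E (ℝ × E) ℝ).flip
      (ContinuousLinearMap.inr ℝ ℝ E)).hasFDerivAt.comp p hΨ.hasFDerivAt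
    have h2 := ((InnerProductSpace.toDual ℝ E).symm.toContinuousLinearEquiv.toContinuousLinearMap
      ).hasFDerivAt.comp p h1
    refine h2.congr_of_eventuallyEq ?_
    filter_upwards [hY] with q hq
    apply (InnerProductSpace.toDual ℝ E).injective
    ext v
    simp [hq]
  have htime : HasFDerivAt (fun q => fderiv ℝ Ψ q (1, 0))
      ((ContinuousLinearMap.apply ℝ ℝ ((1 : ℝ), (0 : E))).comp H) p :=
    (ContinuousLinearMap.apply ℝ ℝ ((1 : ℝ), (0 : E))).hasFDerivAt.comp p hΨ.hasFDerivAt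
  have hcomp := ((hw.hasGradientAt.hasFDerivAt.comp p hYdiff).neg).congr_of_eventuallyEq ht
  have key := DFunLike.congr_fun (htime.unique hcomp) v
  have hsplit : ((1 : ℝ), gradient w (Y p)) = (1, 0) + (0, gradient w (Y p)) := by simp
  rw [hsplit, map_add]
  simp only [ContinuousLinearMap.comp_apply, ContinuousLinearMap.apply_apply,
    neg_apply, InnerProductSpace.toDual_apply_apply] at key
  rw [key, real_inner_comm]
  generalize gradient w (Y p) = a
  simp

end Envelope

/-- The Hessian matrix is singular once the second derivative annihilates a vector with time
component `1`. -/
theorem det_hessMat_eq_zero {n : ℕ} {Ψ : ℝ × EuclideanSpace ℝ (Fin n) → ℝ}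
    {p : ℝ × EuclideanSpace ℝ (Fin n)} {a : EuclideanSpace ℝ (Fin n)}
    (ha : ∀ v, fderiv ℝ (fderiv ℝ Ψ) p v (1, a) = 0) : (hessMat n Ψ p).det = 0 := by
  refine Matrix.exists_mulVec_eq_zero_iff.1 ⟨Fin.cons 1 a.ofLp, fun h => ?_, ?_⟩
  · simpa using congrFun h 0
  · ext i
    have hsum : ((1 : ℝ), a) = baseVec n 0 + ∑ j, a j • baseVec n (Fin.succ j) := by
      have h2 : ∑ j, a j • baseVec n (Fin.succ j)
          = ContinuousLinearMap.inr ℝ ℝ _ (∑ j, a j • EuclideanSpace.single j (1 : ℝ)) := by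
        rw [map_sum]
        simp [baseVec]
      have h3 : ∑ j, a j • EuclideanSpace.single j (1 : ℝ) = a := by
        simpa using (EuclideanSpace.basisFun (Fin n) ℝ).sum_repr a
      rw [h2, h3]
      simp [baseVec]
    have h := ha (baseVec n i)
    rw [hsum] at h
    simpa [Matrix.mulVec, dotProduct, Fin.sum_univ_succ, hessMat, iteratedFDeriv_two_apply,
      mul_comm] using h

/-- The Legendre transform potential `ψ(s,x) = sup_{y∈P}(⟨x,y⟩ - u_s(y))`,
assumed finite, `C²` on `[0,T] × ℝⁿ`, and with a unique maximizer `y(s,x) ∈ P`, satisfies: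
(i) `∇ₓψ(s,x) = y(s,x)` and `∂ψ/∂s(s,x) = -u̇₀(∇ₓψ(s,x))`;
(ii) the Hessian in the joint variables has vanishing determinant on `(0,T) × ℝⁿ`
(i.e. `ψ` solves the homogeneous real Monge–Ampère equation);
(iii) `ψ(0,·)` is the Legendre transform of `u₀` and `∂ψ/∂s(0,x) = -u̇₀(∇(ψ(0,·))(x))`. -/
theorem legendre_transform_potential_solves_HRMA
    (n : ℕ) (P : Set (EuclideanSpace ℝ (Fin n)))
    (hPb : Bornology.IsBounded P) (hPo : IsOpen P) (hPconv : Convex ℝ P)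
    (T : ℝ) (hT : 0 < T)
    (u₀ udot : EuclideanSpace ℝ (Fin n) → ℝ)
    (hu₀ : ContDiffOn ℝ 1 u₀ P) (hudot : ContDiffOn ℝ 1 udot P)
    (Ψ : ℝ × EuclideanSpace ℝ (Fin n) → ℝ)
    (y : ℝ → EuclideanSpace ℝ (Fin n) → EuclideanSpace ℝ (Fin n))
    (hΨ : ∀ s ∈ Icc (0 : ℝ) T, ∀ x, IsLUB
      ((fun z => ⟪x, z⟫ - (u₀ z + s * udot z)) '' P) (Ψ (s, x)))
    (hy : ∀ s ∈ Icc (0 : ℝ) T, ∀ x, y s x ∈ P ∧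
      Ψ (s, x) = ⟪x, y s x⟫ - (u₀ (y s x) + s * udot (y s x)) ∧
      ∀ z ∈ P, Ψ (s, x) = ⟪x, z⟫ - (u₀ z + s * udot z) → z = y s x)
    (hC2 : ContDiffOn ℝ 2 Ψ (Icc (0 : ℝ) T ×ˢ univ)) :
    (∀ s ∈ Icc (0 : ℝ) T, ∀ x,
      gradient (fun z => Ψ (s, z)) x = y s x ∧
      derivWithin (fun t => Ψ (t, x)) (Icc (0 : ℝ) T) s
        = - udot (gradient (fun z => Ψ (s, z)) x)) ∧
    (∀ s ∈ Ioo (0 : ℝ) T, ∀ x, (hessMat n Ψ (s, x)).det = 0) ∧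
    (∀ x, IsLUB ((fun z => ⟪x, z⟫ - u₀ z) '' P) (Ψ (0, x)) ∧
      derivWithin (fun t => Ψ (t, x)) (Icc (0 : ℝ) T) 0
        = - udot (gradient (fun z => Ψ (0, z)) x)) := by
  set S : Set (ℝ × EuclideanSpace ℝ (Fin n)) := Icc (0 : ℝ) T ×ˢ univ
  have hSu : UniqueDiffOn ℝ S := (uniqueDiffOn_Icc hT).prod uniqueDiffOn_univ
  have hdiff : ∀ s ∈ Icc (0 : ℝ) T, ∀ x, DifferentiableWithinAt ℝ Ψ S (s, x) := fun s hs x =>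
    hC2.differentiableOn (by norm_num) (s, x) ⟨hs, mem_univ _⟩
  have hDcont : ContinuousOn (fderivWithin ℝ Ψ S) S :=
    hC2.continuousOn_fderivWithin hSu (by norm_num)
  have hle : ∀ s ∈ Icc (0 : ℝ) T, ∀ x, ∀ z ∈ P, ⟪x, z⟫ - (u₀ z + s * udot z) ≤ Ψ (s, x) :=
    fun s hs x z hz => (hΨ s hs x).1 (mem_image_of_mem _ hz)
  have hspace : ∀ s ∈ Icc (0 : ℝ) T, ∀ x,
      HasFDerivAt (fun z => Ψ (s, z)) (innerSL ℝ (y s x)) x ∧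
        ∀ v, fderivWithin ℝ Ψ S (s, x) (0, v) = ⟪y s x, v⟫ := fun s hs x =>
    fderivWithin_prod_apply_inr_of_touching hs (hdiff s hs x)
      (fun z => hle s hs z _ (hy s hs x).1) (hy s hs x).2.1
  have hgrad : ∀ s ∈ Icc (0 : ℝ) T, ∀ x, gradient (fun z => Ψ (s, z)) x = y s x :=
    fun s hs x => HasGradientAt.gradient (hspace s hs x).1
  have htime_Ioo : ∀ s ∈ Ioo (0 : ℝ) T, ∀ x,
      fderivWithin ℝ Ψ S (s, x) (1, 0) = -udot (y s x) := fun s hs x => by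
    have hs' := Ioo_subset_Icc_self hs
    refine fderivWithin_prod_apply_inl_of_touching (b := ⟪x, y s x⟫ - u₀ (y s x))
      (Icc_mem_nhds hs.1 hs.2) (hdiff s hs' x) (fun t ht => ?_) ?_
    · have := hle t ht x _ (hy s hs' x).1
      linarith
    · have := (hy s hs' x).2.1
      linarith
  have htime : ∀ s ∈ Icc (0 : ℝ) T, ∀ x,
      fderivWithin ℝ Ψ S (s, x) (1, 0) = -udot (y s x) := by
    intro s hs x
    have hDx : ContinuousOn (fun t => fderivWithin ℝ Ψ S (t, x)) (Icc 0 T) :=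
      hDcont.comp (by fun_prop) fun t ht => ⟨ht, mem_univ _⟩
    have hyx : ContinuousOn (fun t => y t x) (Icc 0 T) := by
      have h : ContinuousOn (fun t => (InnerProductSpace.toDual ℝ _).symm
          ((fderivWithin ℝ Ψ S (t, x)).comp (ContinuousLinearMap.inr ℝ ℝ _))) (Icc 0 T) :=
        (InnerProductSpace.toDual ℝ _).symm.continuous.comp_continuousOn
          (hDx.clm_comp continuousOn_const)
      refine h.congr fun t ht => ?_
      apply (InnerProductSpace.toDual ℝ _).injective
      ext v
      simp [(hspace t ht x).2]
    have hr : ContinuousOn (fun t => -udot (y t x)) (Icc 0 T) :=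
      (hudot.continuousOn.comp hyx fun t ht => (hy t ht x).1).neg
    have hl : ContinuousOn (fun t => fderivWithin ℝ Ψ S (t, x) (1, 0)) (Icc 0 T) :=
      hDx.clm_apply continuousOn_const
    have heq : EqOn (fun t => fderivWithin ℝ Ψ S (t, x) (1, 0)) (fun t => -udot (y t x))
        (Ioo 0 T) := fun t ht => htime_Ioo t ht x
    exact heq.of_subset_closure hl hr Ioo_subset_Icc_self (closure_Ioo hT.ne).ge hs
  have hderiv : ∀ s ∈ Icc (0 : ℝ) T, ∀ x,
      derivWithin (fun t => Ψ (t, x)) (Icc (0 : ℝ) T) s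
        = - udot (gradient (fun z => Ψ (s, z)) x) := fun s hs x => by
    rw [hgrad s hs x, ← htime s hs x]
    exact (hasDerivWithinAt_prod_slice (hdiff s hs x)).derivWithin (uniqueDiffOn_Icc hT s hs)
  refine ⟨fun s hs x => ⟨hgrad s hs x, hderiv s hs x⟩, fun s hs x => ?_, fun x => ⟨?_, ?_⟩⟩
  · have hSn : ∀ q ∈ Ioo (0 : ℝ) T ×ˢ (univ : Set (EuclideanSpace ℝ (Fin n))), S ∈ 𝓝 q :=
      fun q hq => prod_mem_nhds (Icc_mem_nhds hq.1.1 hq.1.2) univ_mem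
    have hnear : Ioo (0 : ℝ) T ×ˢ (univ : Set (EuclideanSpace ℝ (Fin n))) ∈ 𝓝 (s, x) :=
      (isOpen_Ioo.prod isOpen_univ).mem_nhds ⟨hs, mem_univ _⟩
    have hs' := Ioo_subset_Icc_self hs
    have hΨ2 : DifferentiableAt ℝ (fderiv ℝ Ψ) (s, x) :=
      ((hC2.contDiffAt (hSn (s, x) ⟨hs, mem_univ _⟩)).fderiv_right (m := 1)
        (by norm_num)).differentiableAt (by norm_num)
    obtain ⟨a, ha⟩ := exists_fderiv_fderiv_apply_eq_zero (w := udot)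
      (Y := fun q => y q.1 q.2) hΨ2
      (by
        filter_upwards [hnear] with q hq v
        rw [← fderivWithin_of_mem_nhds (hSn q hq)]
        exact (hspace q.1 (Ioo_subset_Icc_self hq.1) q.2).2 v)
      (by
        filter_upwards [hnear] with q hq
        rw [← fderivWithin_of_mem_nhds (hSn q hq)]
        exact htime_Ioo q.1 hq.1 q.2)
      ((hudot.differentiableOn (by norm_num)).differentiableAt
        (hPo.mem_nhds (hy s hs' x).1))
    exact det_hessMat_eq_zero ha
  · simpa using hΨ 0 (left_mem_Icc.2 hT.le) x
  · exact hderiv 0 (left_mem_Icc.2 hT.le) x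
end
end

section
/- Let P = {y ∈ ℝⁿ : l_k(y) ≥ 0, k = 1,…,d} be a compact convex polytope with nonempty interior as in the Guillemin-form setup, and let u = u_G + F be of Guillemin form with F of class C¹ on an open neighborhood of P. Then for every x ∈ ℝⁿ, every point y₁ ∈ P at which the function y ↦ ⟨x,y⟩ − u(y) attains its maximum over P lies in the interior of P (in particular no maximizer lies on ∂P). -/
open scoped RealInnerProductSpace
open Set Filter

noncomputable section

/-- The affine-linear defining function `l_k(y) = ⟨y, v_k⟩ - λ_k` of the `k`-th facet. -/
def ell {n d : ℕ} (v : Fin d → EuclideanSpace ℝ (Fin n)) (lam : Fin d → ℝ)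
    (k : Fin d) (y : EuclideanSpace ℝ (Fin n)) : ℝ := ⟪y, v k⟫ - lam k

/-- The polytope `P = {y : l_k(y) ≥ 0, k = 1,…,d}`. -/
def poly {n d : ℕ} (v : Fin d → EuclideanSpace ℝ (Fin n)) (lam : Fin d → ℝ) :
    Set (EuclideanSpace ℝ (Fin n)) := {y | ∀ k, 0 ≤ ell v lam k y}

/-- The Guillemin potential `u_G(y) = Σ_k l_k(y) log l_k(y)` (with `0·log 0 = 0`,
which holds by the convention `Real.log 0 = 0`). -/
def uG {n d : ℕ} (v : Fin d → EuclideanSpace ℝ (Fin n)) (lam : Fin d → ℝ)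
    (y : EuclideanSpace ℝ (Fin n)) : ℝ :=
  ∑ k, ell v lam k y * Real.log (ell v lam k y)

/-- `P ∩ {l_k = 0}` is a facet of `P`: it is nonempty and its affine span has
dimension `n - 1`. -/
def IsFacet {n d : ℕ} (v : Fin d → EuclideanSpace ℝ (Fin n)) (lam : Fin d → ℝ)
    (k : Fin d) : Prop :=
  (poly v lam ∩ {y | ell v lam k y = 0}).Nonempty ∧
  Module.finrank ℝ (affineSpan ℝ (poly v lam ∩ {y | ell v lam k y = 0})).direction = n - 1

/-- Points of the interior of the polytope satisfy all defining inequalities strictly. -/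
theorem ell_pos_of_mem_interior {n d : ℕ} {v : Fin d → EuclideanSpace ℝ (Fin n)}
    {lam : Fin d → ℝ} {k : Fin d} (hv : v k ≠ 0) {z : EuclideanSpace ℝ (Fin n)}
    (hz : z ∈ interior (poly v lam)) : 0 < ell v lam k z := by
  have hc : ContinuousAt (fun t : ℝ => z - t • v k) 0 := by fun_prop
  have hnear : ∀ᶠ t : ℝ in nhdsWithin 0 (Ioi 0), z - t • v k ∈ poly v lam :=
    (hc.eventually (by simpa using mem_interior_iff_mem_nhds.mp hz)).filter_mono
      nhdsWithin_le_nhds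
  obtain ⟨t, ht, ht0⟩ := (hnear.and self_mem_nhdsWithin).exists
  have hk := ht k
  have hpos : 0 < t * ⟪v k, v k⟫ := mul_pos ht0 (real_inner_self_pos.mpr hv)
  simp only [ell, inner_sub_left, real_inner_smul_left] at hk ⊢
  linarith

/-- Points satisfying all defining inequalities strictly lie in the interior. -/
theorem mem_interior_poly_of_ell_pos {n d : ℕ} {v : Fin d → EuclideanSpace ℝ (Fin n)}
    {lam : Fin d → ℝ} {y : EuclideanSpace ℝ (Fin n)} (hy : ∀ k, 0 < ell v lam k y) :
    y ∈ interior (poly v lam) := by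
  rw [mem_interior_iff_mem_nhds]
  have hall : ∀ᶠ y' in nhds y, ∀ k, 0 < ell v lam k y' := by
    rw [eventually_all]
    intro k
    have hc : Continuous (ell v lam k) := by unfold ell; fun_prop
    exact hc.continuousAt.eventually_const_lt (hy k)
  filter_upwards [hall] with y' hy' k using (hy' k).le

theorem ell_lineMap {n d : ℕ} (v : Fin d → EuclideanSpace ℝ (Fin n)) (lam : Fin d → ℝ)
    (k : Fin d) (y z : EuclideanSpace ℝ (Fin n)) (t : ℝ) :
    ell v lam k (y + t • (z - y)) = (1 - t) * ell v lam k y + t * ell v lam k z := by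
  simp only [ell, inner_add_left, real_inner_smul_left, inner_sub_left]
  ring

/-- Along a segment from a point of the facet `l_{k₀} = 0` to a point of the polytope with
`l_{k₀} > 0`, the Guillemin potential exceeds its chord by at most
the negative term `l_{k₀}(z) * t * log t`. -/
theorem uG_segment_le {n d : ℕ} {v : Fin d → EuclideanSpace ℝ (Fin n)} {lam : Fin d → ℝ}
    {y z : EuclideanSpace ℝ (Fin n)} (hy : y ∈ poly v lam) (hz : z ∈ poly v lam)
    {k₀ : Fin d} (hy₀ : ell v lam k₀ y = 0) (hz₀ : 0 < ell v lam k₀ z)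
    {t : ℝ} (ht0 : 0 < t) (ht1 : t ≤ 1) :
    uG v lam (y + t • (z - y)) ≤
      (1 - t) * uG v lam y + t * uG v lam z + ell v lam k₀ z * (t * Real.log t) := by
  have hsum : ell v lam k₀ z * (t * Real.log t) =
      ∑ k, if k = k₀ then ell v lam k₀ z * (t * Real.log t) else 0 := by simp
  unfold uG
  rw [hsum, Finset.mul_sum, Finset.mul_sum, ← Finset.sum_add_distrib,
    ← Finset.sum_add_distrib]
  refine Finset.sum_le_sum fun k _ => ?_
  rw [ell_lineMap]
  split_ifs with hk
  · subst hk
    rw [hy₀, mul_zero, zero_add, Real.log_mul ht0.ne' hz₀.ne']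
    exact le_of_eq (by ring)
  · have := Real.convexOn_mul_log.2 (hy k) (hz k) (sub_nonneg.mpr ht1) ht0.le (by ring)
    simpa only [smul_eq_mul, add_zero] using this

/-- For a potential `u = u_G + F` of Guillemin form on a compact convex
polytope `P` with nonempty interior, every maximizer over `P` of `y ↦ ⟨x,y⟩ - u(y)`
lies in the interior of `P`. -/
theorem maximizer_in_interior
    (n d : ℕ) (v : Fin d → EuclideanSpace ℝ (Fin n)) (lam : Fin d → ℝ)
    (hv : ∀ k, v k ≠ 0)
    (hPc : IsCompact (poly v lam)) (hPint : (interior (poly v lam)).Nonempty)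
    (hfacet : ∀ k, IsFacet v lam k)
    (F : EuclideanSpace ℝ (Fin n) → ℝ) (V : Set (EuclideanSpace ℝ (Fin n)))
    (hV : IsOpen V) (hPV : poly v lam ⊆ V) (hF : ContDiffOn ℝ 1 F V)
    (u : EuclideanSpace ℝ (Fin n) → ℝ) (hu : ∀ y, u y = uG v lam y + F y) :
    ∀ x : EuclideanSpace ℝ (Fin n), ∀ y₁ ∈ poly v lam,
      IsMaxOn (fun y => ⟪x, y⟫ - u y) (poly v lam) y₁ →
      y₁ ∈ interior (poly v lam) := by
  intro x y₁ hy₁ hmax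
  refine mem_interior_poly_of_ell_pos fun k₀ => (hy₁ k₀).lt_of_ne' fun hk₀ => ?_
  obtain ⟨z, hz⟩ := hPint
  have hzP := interior_subset hz
  have hb := ell_pos_of_mem_interior (hv k₀) hz
  have hFd : DifferentiableAt ℝ F y₁ :=
    (hF.differentiableOn one_ne_zero).differentiableAt (hV.mem_nhds (hPV hy₁))
  have hslope := (hFd.hasFDerivAt.hasLineDerivAt (z - y₁)).tendsto_slope_zero_right
  have hlog := Real.tendsto_log_nhdsGT_zero.const_mul_atBot hb
  have hbot := (hslope.add_atBot hlog).eventually_lt_atBot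
    (⟪x, z - y₁⟫ + uG v lam y₁ - uG v lam z)
  have hle1 : ∀ᶠ t : ℝ in nhdsWithin 0 (Ioi 0), t < 1 :=
    (eventually_lt_nhds one_pos).filter_mono nhdsWithin_le_nhds
  obtain ⟨t, ⟨hlt, ht1⟩, ht0⟩ := ((hbot.and hle1).and self_mem_nhdsWithin).exists
  replace ht0 : 0 < t := ht0
  have hmem : y₁ + t • (z - y₁) ∈ poly v lam := fun k => by
    rw [ell_lineMap]
    exact add_nonneg (mul_nonneg (by linarith) (hy₁ k)) (mul_nonneg ht0.le (hzP k))
  have hm := isMaxOn_iff.mp hmax _ hmem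
  have hG := uG_segment_le hy₁ hzP hk₀ hb ht0 ht1.le
  simp only [hu, inner_add_right, real_inner_smul_right] at hm
  simp only [smul_eq_mul] at hlt
  have hmul := mul_lt_mul_of_pos_left hlt ht0
  rw [mul_add, mul_inv_cancel_left₀ ht0.ne'] at hmul
  linarith
end
end

section
/- Let P ⊂ ℝⁿ be a convex set, let N be a positive integer, and let y ∈ ℝⁿ be such that the closed Euclidean ball of radius √n/N centered at y is contained in P. Then for every x ∈ ℝⁿ there exists α ∈ ℤⁿ with α/N ∈ P, ⟨x, α/N − y⟩ ≥ 0, and |α/N − y| ≤ √n/N. -/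
open scoped RealInnerProductSpace
open Set

noncomputable section

/-- The point `α/N ∈ ℝⁿ` associated to a lattice point `α ∈ ℤⁿ`. -/
def latPt {n : ℕ} (α : Fin n → ℤ) (N : ℕ) : EuclideanSpace ℝ (Fin n) :=
  (WithLp.equiv 2 (Fin n → ℝ)).symm fun i => (α i : ℝ) / N

/-- Every real `s` has a multiple of `1/N` within distance `1/N`, on the side of `s` prescribed by
the sign of `t`. -/
lemma exists_int_div_near_of_sign (N : ℕ) (hN : 0 < N) (s t : ℝ) :
    ∃ a : ℤ, 0 ≤ ((a : ℝ) / N - s) * t ∧ |(a : ℝ) / N - s| ≤ 1 / N := by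
  have hN' : (0 : ℝ) < N := by exact_mod_cast hN
  have key (a : ℤ) : (a : ℝ) / N - s = (a - s * N) / N := by field_simp
  rcases le_total 0 t with ht | ht
  · have hle := Int.le_ceil (s * N)
    have hlt := Int.ceil_lt_add_one (s * N)
    refine ⟨⌈s * N⌉, ?_, ?_⟩ <;> rw [key]
    · exact mul_nonneg (div_nonneg (by linarith) hN'.le) ht
    · rw [abs_div, abs_of_pos hN']
      gcongr
      exact abs_le.2 ⟨by linarith, by linarith⟩
  · have hle := Int.floor_le (s * N)
    have hlt := Int.lt_floor_add_one (s * N)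
    refine ⟨⌊s * N⌋, ?_, ?_⟩ <;> rw [key]
    · exact mul_nonneg_of_nonpos_of_nonpos
        (div_nonpos_of_nonpos_of_nonneg (by linarith) hN'.le) ht
    · rw [abs_div, abs_of_pos hN']
      gcongr
      exact abs_le.2 ⟨by linarith, by linarith⟩

/-- A vector of `ℝⁿ` with coordinates bounded by `r` has Euclidean norm at most `√n * r`. -/
lemma EuclideanSpace.norm_le_sqrt_mul_of_abs_le {n : ℕ} {v : EuclideanSpace ℝ (Fin n)} {r : ℝ}
    (hr : 0 ≤ r) (hv : ∀ i, |v i| ≤ r) : ‖v‖ ≤ Real.sqrt n * r := by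
  rw [EuclideanSpace.norm_eq]
  refine Real.sqrt_le_iff.2 ⟨by positivity, ?_⟩
  calc ∑ i, ‖v i‖ ^ 2 ≤ ∑ _i : Fin n, r ^ 2 :=
        Finset.sum_le_sum fun i _ => pow_le_pow_left₀ (norm_nonneg _) (hv i) 2
    _ = (Real.sqrt n * r) ^ 2 := by
        rw [mul_pow, Real.sq_sqrt (Nat.cast_nonneg n)]
        simp

/-- If the closed ball of radius `√n / N` around `y` lies in a convex set
`P ⊆ ℝⁿ`, then for every `x` there is a lattice point `α ∈ ℤⁿ` with `α/N ∈ P`,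
`⟨x, α/N - y⟩ ≥ 0` and `|α/N - y| ≤ √n / N`. -/
theorem lattice_point_in_halfspace
    (n : ℕ) (P : Set (EuclideanSpace ℝ (Fin n))) (hP : Convex ℝ P)
    (N : ℕ) (hN : 0 < N) (y : EuclideanSpace ℝ (Fin n))
    (hball : Metric.closedBall y (Real.sqrt n / N) ⊆ P) :
    ∀ x : EuclideanSpace ℝ (Fin n), ∃ α : Fin n → ℤ,
      latPt α N ∈ P ∧ 0 ≤ ⟪x, latPt α N - y⟫ ∧ ‖latPt α N - y‖ ≤ Real.sqrt n / N := by
  intro x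
  choose α hsign hdist using fun i => exists_int_div_near_of_sign N hN (y i) (x i)
  have hcoord (i : Fin n) : (latPt α N - y) i = (α i : ℝ) / N - y i := rfl
  have hnorm : ‖latPt α N - y‖ ≤ Real.sqrt n / N := by
    rw [div_eq_mul_one_div]
    exact EuclideanSpace.norm_le_sqrt_mul_of_abs_le (by positivity) fun i => hcoord i ▸ hdist i
  refine ⟨α, hball (mem_closedBall_iff_norm.2 hnorm), ?_, hnorm⟩
  rw [PiLp.inner_apply]
  exact Finset.sum_nonneg fun i _ => hsign i
end
end

section
/- Let P = {y ∈ ℝⁿ : l_k(y) ≥ 0, k = 1,…,d} be a compact convex simple polytope with nonempty interior as in the Guillemin-form setup, and let u = u_G + F be of Guillemin form with F of class C¹ on an open neighborhood of P. Let ψ(x) := sup_{y∈P}(⟨x,y⟩ − u(y)) be the Legendre transform of u. Then for every x ∈ ℝⁿ there exist C > 0 and N₀ ∈ ℕ such that for all integers N ≥ N₀: | log( Σ_{α ∈ ℤⁿ, α/N ∈ P} exp( N·(⟨x, α/N⟩ − u(α/N)) ) ) − N·ψ(x) | ≤ C·log N. -/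
open scoped RealInnerProductSpace
open Set Filter

noncomputable section

lemma ell_combo {n d : ℕ} (v : Fin d → EuclideanSpace ℝ (Fin n)) (lam : Fin d → ℝ)
    (k : Fin d) (y z : EuclideanSpace ℝ (Fin n)) {a b : ℝ} (hab : a + b = 1) :
    ell v lam k (a • y + b • z) = a * ell v lam k y + b * ell v lam k z := by
  simp only [ell, inner_add_left, real_inner_smul_left]
  linear_combination lam k * hab

lemma continuous_ell {n d : ℕ} (v : Fin d → EuclideanSpace ℝ (Fin n)) (lam : Fin d → ℝ)
    (k : Fin d) : Continuous (ell v lam k) := by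
  unfold ell
  fun_prop

lemma continuous_uG {n d : ℕ} (v : Fin d → EuclideanSpace ℝ (Fin n)) (lam : Fin d → ℝ) :
    Continuous (uG v lam) := by
  unfold uG
  exact continuous_finsetSum _ fun k _ =>
    Real.continuous_mul_log.comp (continuous_ell v lam k)

lemma convex_poly {n d : ℕ} (v : Fin d → EuclideanSpace ℝ (Fin n)) (lam : Fin d → ℝ) :
    Convex ℝ (poly v lam) := by
  intro y hy z hz a b ha hb hab k
  rw [ell_combo v lam k y z hab]
  exact add_nonneg (mul_nonneg ha (hy k)) (mul_nonneg hb (hz k))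

lemma latPt_apply {n : ℕ} (α : Fin n → ℤ) (N : ℕ) (i : Fin n) :
    latPt α N i = (α i : ℝ) / N := rfl

/-- A function differentiable at `y₀` is bounded above by a cone with vertex at `y₀`. -/
lemma exists_eventually_le_add_norm_of_differentiableAt {E : Type*} [NormedAddCommGroup E]
    [NormedSpace ℝ E] {f : E → ℝ} {y₀ : E} (hf : DifferentiableAt ℝ f y₀) (s : Set E) :
    ∃ C : ℝ, ∀ᶠ y in nhdsWithin y₀ s, f y ≤ f y₀ + C * ‖y - y₀‖ := by
  obtain ⟨C, hC⟩ := hf.hasFDerivAt.isBigO_sub.bound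
  refine ⟨C, nhdsWithin_le_nhds (hC.mono fun y hy => ?_)⟩
  linarith [le_abs_self (f y - f y₀), Real.norm_eq_abs (f y - f y₀)]

/-- The Guillemin potential is bounded above near any point of `P` by a cone: where a defining
function vanishes, the corresponding summand is nonpositive nearby. -/
lemma exists_eventually_uG_le {n d : ℕ} (v : Fin d → EuclideanSpace ℝ (Fin n))
    (lam : Fin d → ℝ) (y₀ : EuclideanSpace ℝ (Fin n)) :
    ∃ C : ℝ, ∀ᶠ y in nhdsWithin y₀ (poly v lam), uG v lam y ≤ uG v lam y₀ + C * ‖y - y₀‖ := by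
  have key : ∀ k, ∃ C : ℝ, ∀ᶠ y in nhdsWithin y₀ (poly v lam),
      ell v lam k y * Real.log (ell v lam k y)
        ≤ ell v lam k y₀ * Real.log (ell v lam k y₀) + C * ‖y - y₀‖ := by
    intro k
    by_cases h : ell v lam k y₀ = 0
    · refine ⟨0, ?_⟩
      have hlt : ∀ᶠ y in nhdsWithin y₀ (poly v lam), ell v lam k y < 1 :=
        nhdsWithin_le_nhds ((continuous_ell v lam k).continuousAt.eventually_lt
          continuousAt_const (by rw [h]; exact one_pos))
      filter_upwards [hlt, self_mem_nhdsWithin] with y hy hyP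
      rw [h]
      simpa using Real.mul_log_nonpos (hyP k) hy.le
    · have hd : DifferentiableAt ℝ (ell v lam k) y₀ := 
        (differentiableAt_id.inner ℝ (differentiableAt_const _)).sub_const _
      exact exists_eventually_le_add_norm_of_differentiableAt (hd.mul (hd.log h)) _
  choose C hC using key
  refine ⟨∑ k, C k, ?_⟩
  filter_upwards [eventually_all.2 hC] with y hy
  unfold uG
  rw [Finset.sum_mul, ← Finset.sum_add_distrib]
  exact Finset.sum_le_sum fun k _ => hy k

/-- Every point is within `(n + 1) / N` of a point of the lattice `N⁻¹ ℤⁿ`. -/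
lemma exists_latPt_norm_sub_le {n : ℕ} (z : EuclideanSpace ℝ (Fin n)) {N : ℕ} (hN : 0 < N) :
    ∃ α : Fin n → ℤ, ‖latPt α N - z‖ ≤ (n + 1) / N := by
  have hN' : (0 : ℝ) < N := by exact_mod_cast hN
  refine ⟨fun i => round (N * z i), ?_⟩
  rw [EuclideanSpace.norm_eq]
  refine Real.sqrt_le_iff.2 ⟨by positivity, ?_⟩
  have hle : ∀ i, ‖(latPt (fun i => round (N * z i)) N - z) i‖ ^ 2 ≤ (1 / (N : ℝ)) ^ 2 := by
    intro i
    refine pow_le_pow_left₀ (norm_nonneg _) ?_ 2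
    have h := abs_sub_round ((N : ℝ) * z i)
    rw [PiLp.sub_apply, latPt_apply, Real.norm_eq_abs, abs_sub_comm,
      show z i - (round (N * z i) : ℝ) / N = (N * z i - round (N * z i)) / N by field_simp,
      abs_div, abs_of_pos hN']
    gcongr
    linarith
  refine (Finset.sum_le_sum fun i _ => hle i).trans ?_
  simp only [Finset.sum_const, Finset.card_univ, Fintype.card_fin, nsmul_eq_mul, div_pow]
  rw [← mul_div_assoc]
  gcongr
  have : (0 : ℝ) ≤ n := n.cast_nonneg
  nlinarith

/-- A convex set with nonempty interior contains, for large `N`, a point of `N⁻¹ ℤⁿ` within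
`O(1 / N)` of any given point of the set. -/
lemma Convex.exists_latPt_mem {n : ℕ} {P : Set (EuclideanSpace ℝ (Fin n))} (hP : Convex ℝ P)
    (hint : (interior P).Nonempty) {y : EuclideanSpace ℝ (Fin n)} (hy : y ∈ P) :
    ∃ A : ℝ, ∃ N₀ : ℕ, ∀ N : ℕ, N₀ ≤ N →
      ∃ α : Fin n → ℤ, latPt α N ∈ P ∧ ‖latPt α N - y‖ ≤ A / N := by
  obtain ⟨p, hp⟩ := hint
  obtain ⟨r, hr, hball⟩ := Metric.nhds_basis_closedBall.mem_iff.1 (mem_interior_iff_mem_nhds.1 hp)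
  obtain ⟨N₁, hN₁⟩ := exists_nat_ge ((n + 1) / r)
  refine ⟨(n + 1) / r * ‖p - y‖ + (n + 1), max N₁ 1, fun N hN => ?_⟩
  have hN0 : 0 < N := lt_of_lt_of_le one_pos ((le_max_right _ _).trans hN)
  have hN' : (0 : ℝ) < N := by exact_mod_cast hN0
  have hN₁N : (N₁ : ℝ) ≤ N := by exact_mod_cast (le_max_left _ _).trans hN
  set t : ℝ := (n + 1) / r / N with ht
  have ht0 : 0 < t := by positivity
  have ht1 : t ≤ 1 := (div_le_one hN').2 (hN₁.trans hN₁N)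
  obtain ⟨α, hα⟩ := exists_latPt_norm_sub_le ((1 - t) • y + t • p) hN0
  set e := latPt α N - ((1 - t) • y + t • p) with he
  have htr : t * r = (n + 1) / N := by rw [ht]; field_simp
  refine ⟨α, ?_, ?_⟩
  · have hq : p + t⁻¹ • e ∈ P := by
      refine hball (mem_closedBall_iff_norm.2 ?_)
      rw [add_sub_cancel_left, norm_smul, norm_inv, Real.norm_of_nonneg ht0.le,
        inv_mul_le_iff₀ ht0, htr]
      exact hα
    have := hP hy hq (sub_nonneg.2 ht1) ht0.le (by ring)
    rwa [smul_add, smul_inv_smul₀ ht0.ne', ← add_assoc, he, add_sub_cancel] at this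
  · have hdec : latPt α N - y = t • (p - y) + e := by rw [he]; module
    rw [hdec]
    refine (norm_add_le _ _).trans ?_
    rw [norm_smul, Real.norm_of_nonneg ht0.le, add_div, ht]
    exact add_le_add (le_of_eq (by ring)) hα

/-- A bounded set contains `O(Nⁿ)` points of `N⁻¹ ℤⁿ`. -/
lemma Bornology.IsBounded.exists_card_latPt_le {n : ℕ} {P : Set (EuclideanSpace ℝ (Fin n))}
    (hP : Bornology.IsBounded P) :
    ∃ M : ℕ, ∀ N : ℕ, 0 < N → Finite {α : Fin n → ℤ // latPt α N ∈ P} ∧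
      Nat.card {α : Fin n → ℤ // latPt α N ∈ P} ≤ ((2 * M + 1) * N) ^ n := by
  obtain ⟨R, hR⟩ := hP.exists_norm_le
  obtain ⟨M, hM⟩ := exists_nat_ge R
  refine ⟨M, fun N hN => ?_⟩
  have hN' : (0 : ℝ) < N := by exact_mod_cast hN
  let S : Finset (Fin n → ℤ) := Fintype.piFinset fun _ => Finset.Icc (-((M * N : ℕ) : ℤ)) (M * N : ℕ)
  have hS : {α : Fin n → ℤ | latPt α N ∈ P} ⊆ S := by
    intro α hα
    simp only [S, Finset.mem_coe, Fintype.mem_piFinset, Finset.mem_Icc]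
    intro i
    have h := (PiLp.norm_apply_le (latPt α N) i).trans ((hR _ hα).trans hM)
    rw [latPt_apply, norm_div, Real.norm_of_nonneg hN'.le, div_le_iff₀ hN', Real.norm_eq_abs,
      abs_le] at h
    constructor
    · have := h.1
      exact_mod_cast this
    · have := h.2
      exact_mod_cast this
  refine ⟨(S.finite_toSet.subset hS).to_subtype, ?_⟩
  have hcard : S.card = (2 * M * N + 1) ^ n := by
    simp only [S, Fintype.card_piFinset, Int.card_Icc, Finset.prod_const, Finset.card_univ,
      Fintype.card_fin]
    congr 1
    push_cast
    grind
  calc Nat.card {α : Fin n → ℤ // latPt α N ∈ P} ≤ Nat.card (S : Set (Fin n → ℤ)) :=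
        Nat.card_mono S.finite_toSet hS
    _ = (2 * M * N + 1) ^ n := by rw [Nat.card_eq_card_toFinset, Finset.toFinset_coe, hcard]
    _ ≤ ((2 * M + 1) * N) ^ n := Nat.pow_le_pow_left (by nlinarith) n

lemma le_log_tsum_exp {ι : Type*} [Finite ι] (f : ι → ℝ) (i : ι) :
    f i ≤ Real.log (∑' j, Real.exp (f j)) := by
  have := Fintype.ofFinite ι
  rw [tsum_fintype]
  have hle : Real.exp (f i) ≤ ∑ j, Real.exp (f j) :=
    Finset.single_le_sum (f := fun j => Real.exp (f j)) (fun _ _ => (Real.exp_pos _).le)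
      (Finset.mem_univ i)
  exact (Real.le_log_iff_exp_le ((Real.exp_pos _).trans_le hle)).2 hle

lemma log_tsum_exp_le {ι : Type*} [Finite ι] [Nonempty ι] {f : ι → ℝ} {m : ℝ}
    (hf : ∀ i, f i ≤ m) :
    Real.log (∑' j, Real.exp (f j)) ≤ Real.log (Nat.card ι) + m := by
  have := Fintype.ofFinite ι
  have hcard : (Nat.card ι : ℝ) ≠ 0 := by exact_mod_cast Nat.card_pos.ne'
  rw [tsum_fintype, ← Real.log_exp m, ← Real.log_mul hcard (Real.exp_ne_zero _)]
  refine Real.log_le_log (Finset.sum_pos (fun _ _ => Real.exp_pos _) Finset.univ_nonempty) ?_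
  calc ∑ j, Real.exp (f j) ≤ ∑ _j : ι, Real.exp m :=
        Finset.sum_le_sum fun j _ => Real.exp_le_exp.2 (hf j)
    _ = Nat.card ι * Real.exp m := by simp [Nat.card_eq_fintype_card]

/-- For a potential `u = u_G + F` of Guillemin form on a compact convex
*simple* polytope `P` with nonempty interior, with Legendre transform
`ψ(x) = sup_{y∈P}(⟨x,y⟩ - u(y))`, for every `x` there are `C > 0` and `N₀` such that for
all `N ≥ N₀`:
`| log Σ_{α ∈ ℤⁿ, α/N ∈ P} exp(N(⟨x, α/N⟩ - u(α/N))) - N ψ(x) | ≤ C log N`. -/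
theorem lattice_sum_log_asymptotics
    (n d : ℕ) (v : Fin d → EuclideanSpace ℝ (Fin n)) (lam : Fin d → ℝ)
    (hv : ∀ k, v k ≠ 0)
    (hPc : IsCompact (poly v lam)) (hPint : (interior (poly v lam)).Nonempty)
    (hfacet : ∀ k, IsFacet v lam k)
    (hsimple : ∀ y ∈ poly v lam,
      LinearIndependent ℝ (fun k : {k : Fin d // ell v lam k y = 0} => v k.1))
    (F : EuclideanSpace ℝ (Fin n) → ℝ) (V : Set (EuclideanSpace ℝ (Fin n)))
    (hV : IsOpen V) (hPV : poly v lam ⊆ V) (hF : ContDiffOn ℝ 1 F V)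
    (u : EuclideanSpace ℝ (Fin n) → ℝ) (hu : ∀ y, u y = uG v lam y + F y)
    (ψ : EuclideanSpace ℝ (Fin n) → ℝ)
    (hψ : ∀ x, ψ x = sSup ((fun y => ⟪x, y⟫ - u y) '' poly v lam)) :
    ∀ x : EuclideanSpace ℝ (Fin n), ∃ C > (0 : ℝ), ∃ N₀ : ℕ, ∀ N : ℕ, N₀ ≤ N →
      |Real.log (∑' α : {α : Fin n → ℤ // latPt α N ∈ poly v lam},
          Real.exp (N * (⟪x, latPt α.1 N⟫ - u (latPt α.1 N))))
        - N * ψ x| ≤ C * Real.log N := by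
  intro x
  have hPne : (poly v lam).Nonempty := hPint.mono interior_subset
  have hcont : ContinuousOn (fun y => ⟪x, y⟫ - u y) (poly v lam) := by
    rw [show u = fun y => uG v lam y + F y from funext hu]
    have h₁ : ContinuousOn (fun y => ⟪x, y⟫) (poly v lam) := by fun_prop
    exact h₁.sub ((continuous_uG v lam).continuousOn.add (hF.continuousOn.mono hPV))
  obtain ⟨y₀, hy₀, hmax⟩ := hPc.exists_isMaxOn hPne hcont
  have hψx : ψ x = ⟪x, y₀⟫ - u y₀ := by
    rw [hψ]
    exact IsGreatest.csSup_eq ⟨mem_image_of_mem _ hy₀, forall_mem_image.2 fun y hy => hmax hy⟩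
  obtain ⟨B, hB⟩ : ∃ B : ℝ, ∀ᶠ y in nhdsWithin y₀ (poly v lam),
      ψ x ≤ ⟪x, y⟫ - u y + B * ‖y - y₀‖ := by
    obtain ⟨C₁, h₁⟩ := exists_eventually_uG_le v lam y₀
    have hVy : V ∈ nhds y₀ := hV.mem_nhds (hPV hy₀)
    have hFd : DifferentiableAt ℝ (fun y => F y - ⟪x, y⟫) y₀ :=
      ((hF.contDiffAt hVy).differentiableAt one_ne_zero).sub
        ((differentiableAt_const x).inner ℝ differentiableAt_id)
    obtain ⟨C₂, h₂⟩ := exists_eventually_le_add_norm_of_differentiableAt hFd (poly v lam)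
    refine ⟨C₁ + C₂, ?_⟩
    filter_upwards [h₁, h₂] with y hy₁ hy₂
    rw [hψx, hu, hu]
    linarith
  obtain ⟨δ, hδ, hδB⟩ := Metric.mem_nhdsWithin_iff.1 hB
  obtain ⟨A, N₁, hA⟩ := (convex_poly v lam).exists_latPt_mem hPint hy₀
  obtain ⟨M, hM⟩ := hPc.isBounded.exists_card_latPt_le
  obtain ⟨N₂, hN₂⟩ := exists_nat_gt (A / δ)
  have hlogM : 0 ≤ Real.log (2 * M + 1) :=
    Real.log_nonneg (by linarith [(Nat.cast_nonneg M : (0 : ℝ) ≤ M)])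
  refine ⟨n * (Real.log (2 * M + 1) + 1) + |B| * |A| + 1, by positivity, max (max N₁ N₂) 3,
    fun N hN => ?_⟩
  simp only [max_le_iff] at hN
  obtain ⟨⟨hNN₁, hNN₂⟩, hN3⟩ := hN
  have hN' : (0 : ℝ) < N := by exact_mod_cast (by lia : 0 < N)
  have hlogN : 1 ≤ Real.log N := by
    rw [Real.le_log_iff_exp_le hN']
    exact Real.exp_one_lt_three.le.trans (by exact_mod_cast hN3)
  obtain ⟨hfin, hcard⟩ := hM N (by lia)
  obtain ⟨α, hαP, hα⟩ := hA N hNN₁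
  have hne : Nonempty {α : Fin n → ℤ // latPt α N ∈ poly v lam} := ⟨⟨α, hαP⟩⟩
  have hlog := le_log_tsum_exp (fun α : {α : Fin n → ℤ // latPt α N ∈ poly v lam} =>
    N * (⟪x, latPt α.1 N⟫ - u (latPt α.1 N))) ⟨α, hαP⟩
  have hlog' := log_tsum_exp_le (f := fun α : {α : Fin n → ℤ // latPt α N ∈ poly v lam} =>
    N * (⟪x, latPt α.1 N⟫ - u (latPt α.1 N))) (m := N * ψ x)
    fun β => mul_le_mul_of_nonneg_left ((hmax β.2).trans_eq hψx.symm) hN'.le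
  generalize Real.log (∑' α : {α : Fin n → ℤ // latPt α N ∈ poly v lam},
    Real.exp (N * (⟪x, latPt α.1 N⟫ - u (latPt α.1 N)))) = L at hlog hlog' ⊢
  have hlower : N * ψ x - |B| * |A| ≤ L := by
    have hlt : A / N < δ := by
      rw [div_lt_iff₀ hN', ← div_lt_iff₀' hδ]
      exact hN₂.trans_le (by exact_mod_cast hNN₂)
    have h := hδB ⟨mem_ball_iff_norm.2 (hα.trans_lt hlt), hαP⟩
    have hBA : B * ‖latPt α N - y₀‖ ≤ |B| * (|A| / N) := by
      gcongr
      · exact le_abs_self B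
      · exact hα.trans (by gcongr; exact le_abs_self A)
    have h' : ψ x ≤ ⟪x, latPt α N⟫ - u (latPt α N) + |B| * (|A| / N) := h.trans (by gcongr)
    have h'' := mul_le_mul_of_nonneg_left h' hN'.le
    have hcancel : (N : ℝ) * (|B| * (|A| / N)) = |B| * |A| := by field_simp
    linarith
  have hupper : L ≤ n * (Real.log (2 * M + 1) + Real.log N) + N * ψ x := by
    have hM0 : (0 : ℝ) < 2 * M + 1 := by positivity
    have hc : (Nat.card {α : Fin n → ℤ // latPt α N ∈ poly v lam} : ℝ)
        ≤ ((2 * M + 1) * N) ^ n := by exact_mod_cast hcard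
    have h := Real.log_le_log (by exact_mod_cast Nat.card_pos) hc
    rw [Real.log_pow, Real.log_mul hM0.ne' hN'.ne'] at h
    linarith
  have hn0 : (0 : ℝ) ≤ n := n.cast_nonneg
  have hBA0 : 0 ≤ |B| * |A| := by positivity
  have hnM : 0 ≤ n * Real.log (2 * M + 1) := mul_nonneg hn0 hlogM
  rw [abs_le]
  constructor <;> linarith [mul_le_mul_of_nonneg_left hlogN hBA0,
    mul_le_mul_of_nonneg_left hlogN hnM, mul_le_mul_of_nonneg_left hlogN hn0]
end
end

section
/- Let S ⊂ ℤⁿ be a finite set whose convex hull P := conv(S) has nonempty interior. Then there exists a constant C > 0 such that for every positive integer N and every y ∈ P there exists α ∈ ℤⁿ with α/N ∈ P and |α/N − y| ≤ C/N. -/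
open Set

noncomputable section

/-- A lattice vector `α ∈ ℤⁿ` viewed as a point of `ℝⁿ`. -/
def intPt {n : ℕ} (α : Fin n → ℤ) : EuclideanSpace ℝ (Fin n) :=
  (WithLp.equiv 2 (Fin n → ℝ)).symm fun i => (α i : ℝ)

/-- Nonnegative weights of total mass one, multiplied by `N`, can be rounded to natural numbers
of sum `N`, with an error of at most one away from a chosen index. -/
lemma exists_nat_rounding {ι : Type*} [DecidableEq ι] {S : Finset ι} {w : ι → ℝ}
    (hw : ∀ i ∈ S, 0 ≤ w i) (hw1 : ∑ i ∈ S, w i = 1) {j : ι} (hj : j ∈ S) (N : ℕ) :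
    ∃ k : ι → ℕ, ∑ i ∈ S, k i = N ∧ ∀ i ∈ S, i ≠ j → |(k i : ℝ) - N * w i| ≤ 1 := by
  have hle : ∑ i ∈ S.erase j, ⌊N * w i⌋₊ ≤ N := by
    have h : ∑ i ∈ S.erase j, (⌊N * w i⌋₊ : ℝ) ≤ N := calc
      _ ≤ ∑ i ∈ S.erase j, N * w i := Finset.sum_le_sum fun i hi =>
          Nat.floor_le (mul_nonneg N.cast_nonneg (hw i (Finset.mem_of_mem_erase hi)))
      _ ≤ ∑ i ∈ S, N * w i := Finset.sum_le_sum_of_subset_of_nonneg (Finset.erase_subset _ _)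
          fun i hi _ => mul_nonneg N.cast_nonneg (hw i hi)
      _ = N := by rw [← Finset.mul_sum, hw1, mul_one]
    exact_mod_cast h
  refine ⟨Function.update (fun i => ⌊N * w i⌋₊) j (N - ∑ i ∈ S.erase j, ⌊N * w i⌋₊), ?_, ?_⟩
  · rw [Finset.sum_update_of_mem hj, Finset.sdiff_singleton_eq_erase]
    omega
  · intro i hi hij
    rw [Function.update_of_ne hij, abs_le]
    have h₁ := Nat.floor_le (mul_nonneg N.cast_nonneg (hw i hi) : 0 ≤ N * w i)
    have h₂ := Nat.lt_floor_add_one (N * w i)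
    constructor <;> linarith

lemma intPt_injective {n : ℕ} : Function.Injective (intPt (n := n)) := by
  intro α β h
  ext i
  have := congrArg (fun x : EuclideanSpace ℝ (Fin n) => x i) h
  simpa [intPt] using this

lemma latPt_sum_mul {n : ℕ} (S : Finset (Fin n → ℤ)) (k : (Fin n → ℤ) → ℕ) (N : ℕ) :
    latPt (∑ s ∈ S, (k s : ℤ) • s) N = ∑ s ∈ S, ((k s : ℝ) / N) • intPt s := by
  ext i
  simp [latPt, intPt, Finset.sum_apply, Finset.sum_div, div_mul_eq_mul_div]

/-- Two combinations of the same points with equal total weight are close when the weights are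
close away from a chosen index. -/
lemma norm_sum_smul_sub_sum_smul_le {ι E : Type*} [NormedAddCommGroup E] [NormedSpace ℝ E]
    {S : Finset ι} {v w : ι → ℝ} (h : ∑ i ∈ S, v i = ∑ i ∈ S, w i) (x : ι → E) (j : ι) {ε : ℝ}
    (hε : ∀ i ∈ S, i ≠ j → |v i - w i| ≤ ε) :
    ‖∑ i ∈ S, v i • x i - ∑ i ∈ S, w i • x i‖ ≤ ε * ∑ i ∈ S, ‖x i - x j‖ := by
  have key : ∑ i ∈ S, v i • x i - ∑ i ∈ S, w i • x i = ∑ i ∈ S, (v i - w i) • (x i - x j) := by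
    simp only [smul_sub, Finset.sum_sub_distrib, ← Finset.sum_smul, sub_smul, h]
    simp
  rw [key, Finset.mul_sum]
  refine norm_sum_le_of_le S fun i hi => ?_
  rcases eq_or_ne i j with rfl | hij
  · simp
  · rw [norm_smul, Real.norm_eq_abs]
    exact mul_le_mul_of_nonneg_right (hε i hi hij) (norm_nonneg _)

/-- For a lattice polytope `P = conv(S)`, `S ⊆ ℤⁿ` finite, with nonempty
interior, the points `{α/N : α ∈ ℤⁿ, α/N ∈ P}` are `C/N`-dense in `P`, with `C` uniform
in `N`. -/
theorem lattice_points_dense_in_polytope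
    (n : ℕ) (S : Finset (Fin n → ℤ))
    (P : Set (EuclideanSpace ℝ (Fin n)))
    (hP : P = convexHull ℝ (intPt '' (S : Set (Fin n → ℤ))))
    (hPint : (interior P).Nonempty) :
    ∃ C > (0 : ℝ), ∀ N : ℕ, 0 < N → ∀ y ∈ P, ∃ α : Fin n → ℤ,
      latPt α N ∈ P ∧ ‖latPt α N - y‖ ≤ C / N := by
  classical
  subst hP
  obtain ⟨j, hj⟩ : S.Nonempty := by
    simpa using convexHull_nonempty_iff.1 (hPint.mono interior_subset)
  refine ⟨∑ s ∈ S, ‖intPt s - intPt j‖ + 1, by positivity, fun N hN y hy => ?_⟩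
  have hN' : (0 : ℝ) < N := by exact_mod_cast hN
  rw [← Finset.coe_image, Finset.mem_convexHull'] at hy
  obtain ⟨w, hw, hw1, rfl⟩ := hy
  simp only [Finset.forall_mem_image] at hw
  rw [Finset.sum_image intPt_injective.injOn] at hw1 ⊢
  obtain ⟨k, hk, hkw⟩ := exists_nat_rounding (w := fun s => w (intPt s))
    (fun s hs => hw hs) hw1 hj N
  have hk1 : ∑ s ∈ S, (k s : ℝ) / N = 1 := by
    rw [← Finset.sum_div, ← Nat.cast_sum, hk, div_self hN'.ne']
  refine ⟨∑ s ∈ S, (k s : ℤ) • s, ?_, ?_⟩ <;> rw [latPt_sum_mul]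
  · exact (convex_convexHull ℝ _).sum_mem (fun s _ => by positivity) hk1
      fun s hs => subset_convexHull ℝ _ (mem_image_of_mem _ hs)
  · refine (norm_sum_smul_sub_sum_smul_le (ε := 1 / N) (hk1.trans hw1.symm) intPt j
      fun s hs hsj => ?_).trans ?_
    · rw [div_sub' hN'.ne', abs_div, abs_of_pos hN']
      exact div_le_div_of_nonneg_right (hkw s hs hsj) hN'.le
    · rw [one_div_mul_eq_div]
      gcongr
      linarith
end
end
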